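/- The subset A_S = {α : S → FL(S) | for every a ∈ S there is c ∈ ℚ with α a = c • of a} is an abelian Lie ideal of the space of functions S → FL(S) equipped with the tangential bracket: for all α, β ∈ A_S one has [α,β]_tb = 0, and for every α ∈ A_S and every λ : S → FL(S) one has [α,λ]_tb ∈ A_S. -/

import Mathlib

/-- The tangential bracket on families `S → FL(S)` (where `FL(S) = FreeLieAlgebra ℚ S`),
expressed relative to a choice `pd` of the tangential-derivation map `λ ↦ ∂_λ`:
`([λ₁,λ₂]_tb)(a) = ⁅λ₁ a, λ₂ a⁆ + ∂_{λ₁}(λ₂ a) − ∂_{λ₂}(λ₁ a)`. -/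
noncomputable def tb {S : Type*}
    (pd : (S → FreeLieAlgebra ℚ S) →
      LieDerivation ℚ (FreeLieAlgebra ℚ S) (FreeLieAlgebra ℚ S))
    (l₁ l₂ : S → FreeLieAlgebra ℚ S) : S → FreeLieAlgebra ℚ S :=
  fun a => ⁅l₁ a, l₂ a⁆ + pd l₁ (l₂ a) - pd l₂ (l₁ a)

/-- The subset `A_S` of families `α : S → FL(S)` such that each `α a` is a ℚ-scalar
multiple of the corresponding generator `of a`. -/
def abelianPart (S : Type*) : Set (S → FreeLieAlgebra ℚ S) :=
  {α | ∀ a : S, ∃ c : ℚ, α a = c • FreeLieAlgebra.of ℚ a}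

namespace FreeLieAlgebra

/-- A free Lie algebra is generated by its canonical generators. -/
theorem lieSpan_range_of (R X : Type*) [CommRing R] :
    LieSubalgebra.lieSpan R (FreeLieAlgebra R X) (Set.range (of R)) = ⊤ := by
  set K := LieSubalgebra.lieSpan R (FreeLieAlgebra R X) (Set.range (of R))
  let F : FreeLieAlgebra R X →ₗ⁅R⁆ K :=
    lift R fun x => ⟨of R x, LieSubalgebra.subset_lieSpan (Set.mem_range_self x)⟩
  have hF : K.incl.comp F = LieHom.id := by
    ext x
    simp [F]
  refine eq_top_iff.2 fun y _ => ?_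
  have hy : (F y : FreeLieAlgebra R X) = y := LieHom.congr_fun hF y
  exact hy ▸ (F y).2

/-- A derivation of a free Lie algebra is determined by its values on the generators. -/
theorem lieDerivation_ext {R X : Type*} [CommRing R]
    {D₁ D₂ : LieDerivation R (FreeLieAlgebra R X) (FreeLieAlgebra R X)}
    (h : ∀ x, D₁ (of R x) = D₂ (of R x)) : D₁ = D₂ :=
  LieDerivation.ext_of_lieSpan_eq_top _ (lieSpan_range_of R X) (by rintro _ ⟨x, rfl⟩; exact h x)

end FreeLieAlgebra

/-- Elements of `A_S` are central for the tangential bracket: the tangential derivation of such an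
element vanishes on generators. -/
theorem tb_eq_zero_of_mem_abelianPart {S : Type*}
    {pd : (S → FreeLieAlgebra ℚ S) →
      LieDerivation ℚ (FreeLieAlgebra ℚ S) (FreeLieAlgebra ℚ S)}
    (hpd : ∀ (lam : S → FreeLieAlgebra ℚ S) (a : S),
      pd lam (FreeLieAlgebra.of ℚ a) = ⁅FreeLieAlgebra.of ℚ a, lam a⁆)
    {α : S → FreeLieAlgebra ℚ S} (hα : α ∈ abelianPart S) (lam : S → FreeLieAlgebra ℚ S) :
    tb pd α lam = 0 := by
  have hD : pd α = 0 := FreeLieAlgebra.lieDerivation_ext fun a => by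
    obtain ⟨c, hc⟩ := hα a
    simp [hpd, hc]
  funext a
  obtain ⟨c, hc⟩ := hα a
  simp [tb, hD, hc, hpd]

/-- `A_S` is an abelian Lie ideal of `(S → FL(S), [·,·]_tb)`: the tangential
bracket of any two elements of `A_S` vanishes, and the tangential bracket of an element of
`A_S` with an arbitrary family lies in `A_S`.  Here `pd` assigns to each `λ` the (unique)
tangential derivation `∂_λ`, characterized by `∂_λ (of a) = ⁅of a, λ a⁆`. -/
theorem abelianPart_is_abelian_ideal (S : Type*)
    (pd : (S → FreeLieAlgebra ℚ S) →
      LieDerivation ℚ (FreeLieAlgebra ℚ S) (FreeLieAlgebra ℚ S))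
    (hpd : ∀ (lam : S → FreeLieAlgebra ℚ S) (a : S),
      pd lam (FreeLieAlgebra.of ℚ a) = ⁅FreeLieAlgebra.of ℚ a, lam a⁆) :
    (∀ α ∈ abelianPart S, ∀ β ∈ abelianPart S, tb pd α β = 0) ∧
    (∀ α ∈ abelianPart S, ∀ lam : S → FreeLieAlgebra ℚ S, tb pd α lam ∈ abelianPart S) := by
  exact ⟨fun α hα β _ => tb_eq_zero_of_mem_abelianPart hpd hα β, fun α hα lam a =>
    ⟨0, by simp [tb_eq_zero_of_mem_abelianPart hpd hα lam]⟩⟩
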